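/- Let V : ℝ^d → ℝ satisfy Assumptions 1–3 with min V = 0, let δ₀, g₀, μ⁻, M_Δ, L, ν be the constants described in the context, set C = 4M_Δ/ν², suppose ε ≤ min{ν_eb²/(64 C_g), δ₀²/C, g₀²/(4M_Δ)}, and let U = {x ∈ ℝ^d : dist(x,S) ≤ √(Cε)}. If the uniform (normalized Lebesgue) measure on U satisfies the Poincaré inequality PI(ρ_U), then the truncated Gibbs measure μ_{ε,U} satisfies the Poincaré inequality PI(ρ_{ε,U}) with a constant satisfying exp(4LC)·ρ_{ε,U} ≥ ρ_U. -/

import Mathlib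

open MeasureTheory Real Filter Metric Set
open scoped RealInnerProductSpace ENNReal Topology

noncomputable section

abbrev Euc (n : ℕ) := EuclideanSpace ℝ (Fin n)

variable {d : ℕ}

def localMinSet (V : Euc d → ℝ) : Set (Euc d) := {x | IsLocalMin V x}

def localMaxSet (V : Euc d → ℝ) : Set (Euc d) := {x | IsLocalMax V x}

def hessQ (V : Euc d → ℝ) (x v : Euc d) : ℝ := ⟪fderiv ℝ (gradient V) x v, v⟫

def lap (V : Euc d → ℝ) (x : Euc d) : ℝ :=
  ∑ i, hessQ V x (EuclideanSpace.basisFun (Fin d) ℝ i)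

def PoincareIneq {d : ℕ} (μ : Measure (Euc d)) (ρ : ℝ) : Prop :=
  ∀ f : Euc d → ℝ, ContDiff ℝ 1 f →
    Integrable (fun x => (f x) ^ 2) μ →
    Integrable (fun x => ‖gradient f x‖ ^ 2) μ →
    ∫ x, (f x - ∫ y, f y ∂μ) ^ 2 ∂μ ≤ (1 / ρ) * ∫ x, ‖gradient f x‖ ^ 2 ∂μ

def gibbs (V : Euc d → ℝ) (ε : ℝ) : Measure (Euc d) :=
  (ENNReal.ofReal (∫ x, exp (-V x / ε)))⁻¹ •
    volume.withDensity fun x => ENNReal.ofReal (exp (-V x / ε))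

def gibbsOn (V : Euc d → ℝ) (ε : ℝ) (U : Set (Euc d)) : Measure (Euc d) :=
  (ENNReal.ofReal (∫ x in U, exp (-V x / ε)))⁻¹ •
    (volume.restrict U).withDensity fun x => ENNReal.ofReal (exp (-V x / ε))

def uniformOn {d : ℕ} (U : Set (Euc d)) : Measure (Euc d) :=
  (volume U)⁻¹ • volume.restrict U

def Assumption1 (V : Euc d → ℝ) (ν : ℝ) (𝒩 : Set (Euc d) → Set (Euc d)) : Prop :=
  0 < ν ∧ ∀ x ∈ localMinSet V,
    IsOpen (𝒩 (connectedComponentIn (localMinSet V) x)) ∧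
    connectedComponentIn (localMinSet V) x ⊆ 𝒩 (connectedComponentIn (localMinSet V) x) ∧
    ContDiffOn ℝ 3 V (𝒩 (connectedComponentIn (localMinSet V) x)) ∧
    ∀ y ∈ 𝒩 (connectedComponentIn (localMinSet V) x),
      ν * (V y - sInf (V '' 𝒩 (connectedComponentIn (localMinSet V) x))) ≤ ‖gradient V y‖ ^ 2

def NSet (V : Euc d → ℝ) (𝒩 : Set (Euc d) → Set (Euc d)) : Set (Euc d) :=
  ⋃ x ∈ localMinSet V, 𝒩 (connectedComponentIn (localMinSet V) x)

def Assumption2 (V : Euc d → ℝ) (𝒩 : Set (Euc d) → Set (Euc d)) : Prop :=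
  ∀ x ∉ NSet V 𝒩, gradient V x = 0 → ∀ v : Euc d, v ≠ 0 → hessQ V x v < 0

def Assumption3 (V : Euc d → ℝ) (R₀ ν_eb C_g : ℝ) : Prop :=
  0 < R₀ ∧ 0 < ν_eb ∧ 0 < C_g ∧
  (∀ x : Euc d, R₀ ≤ ‖x‖ →
      ν_eb * infDist x (localMinSet V) ≤ ‖gradient V x‖ ∧ |lap V x| ≤ C_g * ‖x‖ ^ 2) ∧
  Tendsto V (cocompact (Euc d)) atTop ∧
  localMinSet V ⊆ closedBall 0 R₀

/-- The closed `R₁`-neighborhood of the set of local maxima (empty if there are no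
local maxima). -/
def maxNbhd (V : Euc d → ℝ) (R₁ : ℝ) : Set (Euc d) :=
  {y | (localMaxSet V).Nonempty ∧ infDist y (localMaxSet V) ≤ R₁}


lemma aux_grad_contDiff {d : ℕ} (V : Euc d → ℝ) (hV : ContDiff ℝ 2 V) :
    ContDiff ℝ 1 (gradient V) := by
  have h : ContDiff ℝ 1 (fderiv ℝ V) := hV.fderiv_right (by norm_num)
  exact (InnerProductSpace.toDual ℝ (Euc d)).symm.contDiff.comp h

lemma aux_line {d : ℕ} (V : Euc d → ℝ) (hV : ContDiff ℝ 2 V) (p v : Euc d) (t : ℝ) :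
    HasDerivAt (fun s : ℝ => V (p + s • v)) ⟪gradient V (p + t • v), v⟫ t := by
  have h1 : HasDerivAt (fun s : ℝ => p + s • v) v t := by
    simpa using ((hasDerivAt_id t).smul_const v).const_add p
  have h2 : HasFDerivAt V _ (p + t • v) :=
    ((hV.differentiable (by norm_num)) (p + t • v)).hasGradientAt.hasFDerivAt
  have := h2.comp_hasDerivAt t h1
  simpa only [InnerProductSpace.toDual_apply_apply] using! this

lemma aux_locmin_grad {d : ℕ} (V : Euc d → ℝ) (x : Euc d) (hx : x ∈ localMinSet V) :
    gradient V x = 0 := by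
  have : fderiv ℝ V x = 0 := IsLocalMin.fderiv_eq_zero hx
  simp [gradient, this]

lemma aux_N_open {d : ℕ} (V : Euc d → ℝ) (ν : ℝ) (𝒩 : Set (Euc d) → Set (Euc d))
    (h1 : Assumption1 V ν 𝒩) : IsOpen (NSet V 𝒩) :=
  isOpen_biUnion fun x hx => (h1.2 x hx).1

lemma aux_S_sub_N {d : ℕ} (V : Euc d → ℝ) (ν : ℝ) (𝒩 : Set (Euc d) → Set (Euc d))
    (h1 : Assumption1 V ν 𝒩) : localMinSet V ⊆ NSet V 𝒩 := fun x hx =>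
  mem_biUnion hx ((h1.2 x hx).2.1 (mem_connectedComponentIn hx))

lemma aux_S_closed {d : ℕ} (V : Euc d → ℝ) (hV : ContDiff ℝ 2 V)
    (ν : ℝ) (𝒩 : Set (Euc d) → Set (Euc d))
    (h1 : Assumption1 V ν 𝒩) (hmin0 : ∀ x, 0 ≤ V x)
    (δ₀ : ℝ) (hδ₀ : 0 < δ₀)
    (hδ : ∀ x ∈ frontier (NSet V 𝒩), δ₀ ≤ infDist x (localMinSet V)) :
    IsClosed (localMinSet V) := by
  apply isClosed_of_closure_subset
  intro x hx
  have hg : gradient V x = 0 := by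
    have hc : IsClosed {y | gradient V y = 0} :=
      isClosed_eq (aux_grad_contDiff V hV).continuous continuous_const
    exact closure_minimal (fun y hy => aux_locmin_grad V y hy) hc hx
  by_cases hN : x ∈ NSet V 𝒩
  · obtain ⟨s, hs, hxs⟩ := mem_iUnion₂.1 hN
    obtain ⟨ho, -, -, hPL⟩ := h1.2 s hs
    have h := hPL x hxs
    rw [hg] at h
    have h' : V x - sInf (V '' 𝒩 (connectedComponentIn (localMinSet V) s)) ≤ 0 := by
      by_contra hc
      push Not at hc
      have := mul_pos h1.1 hc
      simp at h
      linarith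
    show IsLocalMin V x
    filter_upwards [ho.mem_nhds hxs] with y hy
    have : sInf (V '' 𝒩 (connectedComponentIn (localMinSet V) s)) ≤ V y :=
      csInf_le ⟨0, by rintro _ ⟨z, -, rfl⟩; exact hmin0 z⟩ ⟨y, hy, rfl⟩
    linarith
  · exfalso
    have hf : x ∈ frontier (NSet V 𝒩) := by
      rw [(aux_N_open V ν 𝒩 h1).frontier_eq]
      exact ⟨closure_mono (aux_S_sub_N V ν 𝒩 h1) hx, hN⟩
    have := hδ x hf
    rw [(mem_closure_iff_infDist_zero (closure_nonempty_iff.1 ⟨x, hx⟩)).1 hx] at this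
    linarith

lemma aux_crit {d : ℕ} (V : Euc d → ℝ) (hV : ContDiff ℝ 2 V)
    (ν : ℝ) (hν : 0 < ν) (𝒩 : Set (Euc d) → Set (Euc d))
    (hS : IsClosed (localMinSet V)) (hSn : (localMinSet V).Nonempty)
    (heb : ∀ x ∈ NSet V 𝒩, ν * infDist x (localMinSet V) ≤ ‖gradient V x‖)
    (x : Euc d) (hx : x ∈ closure (NSet V 𝒩)) (hg : gradient V x = 0) :
    x ∈ localMinSet V := by
  have hc : IsClosed {y | ν * infDist y (localMinSet V) ≤ ‖gradient V y‖} :=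
    isClosed_le (continuous_const.mul (continuous_infDist_pt _))
      (aux_grad_contDiff V hV).continuous.norm
  have h : ν * infDist x (localMinSet V) ≤ ‖gradient V x‖ := closure_minimal heb hc hx
  rw [hg, norm_zero] at h
  have h0 : infDist x (localMinSet V) = 0 :=
    le_antisymm (by by_contra hc; push Not at hc; have := mul_pos hν hc; linarith) infDist_nonneg
  exact (hS.mem_iff_infDist_zero hSn).2 h0

lemma aux_U {d : ℕ} (V : Euc d → ℝ) (hV : ContDiff ℝ 2 V)
    (ν : ℝ) (𝒩 : Set (Euc d) → Set (Euc d))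
    (h1 : Assumption1 V ν 𝒩)
    (hS : IsClosed (localMinSet V)) (hSn : (localMinSet V).Nonempty)
    (δ₀ : ℝ) (hδ₀ : 0 < δ₀)
    (hδ : ∀ x ∈ frontier (NSet V 𝒩), δ₀ ≤ infDist x (localMinSet V))
    (L : ℝ) (hL : ∀ x ∈ NSet V 𝒩, ‖fderiv ℝ (gradient V) x‖ ≤ L)
    (x : Euc d) (hx : infDist x (localMinSet V) ≤ δ₀) :
    x ∈ closure (NSet V 𝒩) ∧ ∃ p ∈ localMinSet V, 
      V x ≤ V p + L * infDist x (localMinSet V) ^ 2 := by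
  obtain ⟨p, hp, hpx⟩ := hS.exists_infDist_eq_dist hSn x
  have hN := aux_N_open V ν 𝒩 h1
  have hpN := aux_S_sub_N V ν 𝒩 h1 hp
  have hnorm : ‖x - p‖ ≤ δ₀ := by rw [← dist_eq_norm, ← hpx]; exact hx
  have key : ∀ t ∈ Ico (0:ℝ) 1, p + t • (x - p) ∈ NSet V 𝒩 := by
    intro t ht
    have hpc : IsPreconnected ((fun s : ℝ => p + s • (x - p)) '' Ico 0 1) := by
      apply isPreconnected_Ico.image
      fun_prop
    have hsub : (fun s : ℝ => p + s • (x - p)) '' Ico 0 1 ⊆ NSet V 𝒩 := by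
      by_contra hcon
      have hne : ((fun s : ℝ => p + s • (x - p)) '' Ico 0 1 ∩ (closure (NSet V 𝒩))ᶜ).Nonempty ∨
          ∃ s ∈ Ico (0:ℝ) 1, p + s • (x - p) ∈ frontier (NSet V 𝒩) := by
        obtain ⟨_, ⟨s, hs, rfl⟩, hz⟩ := not_subset.1 hcon
        by_cases hcl : p + s • (x - p) ∈ closure (NSet V 𝒩)
        · right; exact ⟨s, hs, by rw [hN.frontier_eq]; exact ⟨hcl, hz⟩⟩
        · left; exact ⟨_, ⟨s, hs, rfl⟩, hcl⟩
      have hfr : ∃ s ∈ Ico (0:ℝ) 1, p + s • (x - p) ∈ frontier (NSet V 𝒩) := by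
        rcases hne with hne | h
        · by_contra hno
          push Not at hno
          obtain ⟨z, hz, hz1, hz2⟩ := hpc (NSet V 𝒩) (closure (NSet V 𝒩))ᶜ hN 
            isClosed_closure.isOpen_compl (by
              rintro _ ⟨s, hs, rfl⟩
              by_cases hcl : p + s • (x - p) ∈ closure (NSet V 𝒩)
              · left
                by_contra hz
                exact hno s hs (by rw [hN.frontier_eq]; exact ⟨hcl, hz⟩)
              · right; exact hcl) ⟨p, ⟨0, by simp, by simp⟩, hpN⟩ hne
          exact hz2 (subset_closure hz1)
        · exact h
      obtain ⟨s, hs, hf⟩ := hfr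
      have h2 := hδ _ hf
      have h3 : infDist (p + s • (x - p)) (localMinSet V) ≤ dist (p + s • (x - p)) p :=
        infDist_le_dist_of_mem hp
      have h4 : dist (p + s • (x - p)) p = s * ‖x - p‖ := by
        rw [dist_eq_norm, add_sub_cancel_left, norm_smul, Real.norm_of_nonneg hs.1]
      have : s * ‖x - p‖ ≤ s * δ₀ := mul_le_mul_of_nonneg_left hnorm hs.1
      nlinarith [hs.2]
    exact hsub ⟨t, ht, rfl⟩
  refine ⟨?_, p, hp, ?_⟩
  · have hc : Continuous fun s : ℝ => p + s • (x - p) := by fun_prop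
    have : (1:ℝ) ∈ closure (Ico (0:ℝ) 1) := by rw [closure_Ico (by norm_num)]; simp
    have h := map_mem_closure hc this (t := NSet V 𝒩) key
    simpa using h
  · have hgrad : ∀ t ∈ Ioo (0:ℝ) 1, ‖gradient V (p + t • (x - p))‖ ≤ L * ‖x - p‖ := by
      intro t ht
      have hseg : ∀ z ∈ segment ℝ p (p + t • (x - p)), z ∈ NSet V 𝒩 := by
        intro z hz
        rw [segment_eq_image'] at hz
        obtain ⟨θ, hθ, rfl⟩ := hz
        have := key (θ * t) ⟨mul_nonneg hθ.1 ht.1.le, by nlinarith [hθ.1, hθ.2, ht.1, ht.2]⟩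
        simpa [smul_smul] using this
      have h := (convex_segment p (p + t • (x - p))).norm_image_sub_le_of_norm_fderiv_le
        (f := gradient V) (𝕜 := ℝ) (C := L)
        (fun z _ => ((aux_grad_contDiff V hV).differentiable (by norm_num)) z)
        (fun z hz => hL z (hseg z hz)) (left_mem_segment ℝ _ _) (right_mem_segment ℝ _ _)
      rw [aux_locmin_grad V p hp, sub_zero, add_sub_cancel_left, norm_smul,
        Real.norm_of_nonneg ht.1.le] at h
      have hL0 : 0 ≤ L := (norm_nonneg _).trans (hL p hpN)
      have : t * ‖x - p‖ ≤ 1 * ‖x - p‖ := mul_le_mul_of_nonneg_right ht.2.le (norm_nonneg _)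
      exact h.trans (mul_le_mul_of_nonneg_left (by linarith) hL0)
    obtain ⟨t, ht, he⟩ := exists_hasDerivAt_eq_slope (fun s : ℝ => V (p + s • (x - p)))
      (fun s => ⟪gradient V (p + s • (x - p)), x - p⟫) zero_lt_one
      (fun s _ => (aux_line V hV p (x - p) s).continuousAt.continuousWithinAt)
      (fun s _ => aux_line V hV p (x - p) s)
    simp only [one_smul, zero_smul, add_zero, sub_zero, div_one, add_sub_cancel] at he
    have h5 := real_inner_le_norm (gradient V (p + t • (x - p))) (x - p)
    have h6 := mul_le_mul_of_nonneg_right (hgrad t ht) (norm_nonneg (x - p))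
    rw [hpx, dist_eq_norm]
    rw [he] at h5
    nlinarith

lemma aux_cross {X : Type*} [TopologicalSpace X] {s O : Set X} (hs : IsPreconnected s)
    (hO : IsOpen O) (h1 : (s ∩ O).Nonempty) (h2 : (s ∩ Oᶜ).Nonempty) :
    (s ∩ frontier O).Nonempty := by
  by_contra hcon
  have hno : ∀ z ∈ s, z ∉ O → z ∉ closure O := by
    intro z hz hzO hzc
    exact hcon ⟨z, hz, by rw [hO.frontier_eq]; exact ⟨hzc, hzO⟩⟩
  obtain ⟨z, -, hz1, hz2⟩ := hs O (closure O)ᶜ hO isClosed_closure.isOpen_compl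
    (fun z hz => (em (z ∈ O)).imp id (hno z hz)) h1
    (by obtain ⟨z, hz, hz'⟩ := h2; exact ⟨z, hz, hno z hz hz'⟩)
  exact hz2 (subset_closure hz1)

lemma aux_anti {d : ℕ} (V : Euc d → ℝ) (hV : ContDiff ℝ 2 V) (p v : Euc d) (t : ℝ)
    (h : ∀ s ∈ Ioo 0 t, ⟪gradient V (p + s • v), v⟫ < 0) :
    StrictAntiOn (fun s : ℝ => V (p + s • v)) (Icc 0 t) := by
  apply strictAntiOn_of_deriv_neg (convex_Icc 0 t)
  · exact fun s _ => (aux_line V hV p v s).continuousAt.continuousWithinAt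
  · intro s hs
    rw [interior_Icc] at hs
    rw [(aux_line V hV p v s).deriv]
    exact h s hs

lemma aux_noncrit {d : ℕ} (V : Euc d → ℝ) (hV : ContDiff ℝ 2 V) (x : Euc d)
    (hx : gradient V x ≠ 0) :
    ∃ W : Set (Euc d), IsOpen W ∧ x ∈ W ∧
      (∀ y ∈ W, ∀ z ∈ W, V y < V x → V z < V x → JoinedIn {w | V w < V x} y z) ∧
      (∀ z ∈ W, V z ≤ V x → z ∈ closure {w | V w < V x}) := by
  set u := - gradient V x with hu
  have hu0 : 0 < ‖u‖ := by simpa [hu] using hx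
  have hcont : Continuous fun y => ⟪gradient V y, u⟫ :=
    (aux_grad_contDiff V hV).continuous.inner continuous_const
  have hxu : ⟪gradient V x, u⟫ < 0 := by
    rw [hu, inner_neg_right, real_inner_self_eq_norm_sq]
    have : 0 < ‖gradient V x‖ := norm_pos_iff.2 hx
    have := pow_pos this 2
    linarith
  obtain ⟨ρ, hρ, hball⟩ := Metric.isOpen_iff.1 (isOpen_lt hcont continuous_const) x hxu
  set t := ρ / (2 * ‖u‖) with ht
  have ht0 : 0 < t := by positivity
  have htu : t * ‖u‖ = ρ / 2 := by rw [ht]; field_simp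
  have hanti : ∀ y ∈ ball x (ρ / 2), StrictAntiOn (fun s : ℝ => V (y + s • u)) (Icc 0 t) := by
    intro y hy
    apply aux_anti V hV
    intro s hs
    apply hball
    rw [mem_ball, dist_eq_norm] at *
    have h1 : ‖y + s • u - x‖ ≤ ‖y - x‖ + ‖s • u‖ := by
      have : y + s • u - x = (y - x) + s • u := by abel
      rw [this]; exact norm_add_le _ _
    rw [norm_smul, Real.norm_of_nonneg hs.1.le] at h1
    have : s * ‖u‖ ≤ t * ‖u‖ := mul_le_mul_of_nonneg_right hs.2.le hu0.le
    linarith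
  have hxt : V (x + t • u) < V x := by
    have := hanti x (mem_ball_self (by positivity)) (left_mem_Icc.2 ht0.le)
      (right_mem_Icc.2 ht0.le) ht0
    simpa using this
  obtain ⟨δ, hδ, hδb⟩ := Metric.isOpen_iff.1 (isOpen_lt hV.continuous continuous_const) _ hxt
  have hup : ∀ y ∈ ball x (ρ / 2), V y < V x → JoinedIn {w | V w < V x} y (y + t • u) := by
    intro y hy hyx
    apply JoinedIn.of_segment_subset
    intro w hw
    rw [segment_eq_image'] at hw
    obtain ⟨θ, hθ, rfl⟩ := hw
    have := (hanti y hy).antitoneOn (left_mem_Icc.2 ht0.le)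
      (⟨mul_nonneg hθ.1 ht0.le, by nlinarith [hθ.2]⟩ : θ * t ∈ Icc 0 t) (mul_nonneg hθ.1 ht0.le)
    simp only [zero_smul, add_zero] at this
    simp only [mem_ofPred_eq, add_sub_cancel_left, smul_smul]
    linarith
  refine ⟨ball x (min δ (ρ / 2)), isOpen_ball, mem_ball_self (by positivity), ?_, ?_⟩
  · intro y hy z hz hyx hzx
    have hy' := ball_subset_ball (min_le_right δ (ρ / 2)) hy
    have hz' := ball_subset_ball (min_le_right δ (ρ / 2)) hz
    have hm : JoinedIn {w | V w < V x} (y + t • u) (z + t • u) := by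
      apply JoinedIn.of_segment_subset
      refine ((convex_ball (x + t • u) δ).segment_subset ?_ ?_).trans hδb
      · have := ball_subset_ball (min_le_left δ (ρ / 2)) hy
        simpa [dist_add_right] using this
      · have := ball_subset_ball (min_le_left δ (ρ / 2)) hz
        simpa [dist_add_right] using this
    exact ((hup y hy' hyx).trans hm).trans (hup z hz' hzx).symm
  · intro z hz hzx
    have hz' := ball_subset_ball (min_le_right δ (ρ / 2)) hz
    have hc : Continuous fun s : ℝ => z + s • u := by fun_prop
    have h0 : (0:ℝ) ∈ closure (Ioo (0:ℝ) t) := by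
      rw [closure_Ioo ht0.ne]; exact left_mem_Icc.2 ht0.le
    have h := map_mem_closure hc h0 (t := {w | V w < V x}) (by
      intro s hs
      have := hanti z hz' (left_mem_Icc.2 ht0.le) (Ioo_subset_Icc_self hs) hs.1
      simp only [zero_smul, add_zero] at this
      exact this.trans_le hzx)
    simpa using h

lemma aux_strictmax {d : ℕ} (hd : 2 ≤ d) (V : Euc d → ℝ) (hV : ContDiff ℝ 2 V) (x : Euc d)
    (hx : gradient V x = 0) (hH : ∀ v : Euc d, v ≠ 0 → hessQ V x v < 0) :
    ∃ W : Set (Euc d), IsOpen W ∧ x ∈ W ∧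
      (∀ y ∈ W, ∀ z ∈ W, V y < V x → V z < V x → JoinedIn {w | V w < V x} y z) ∧
      (∀ z ∈ W, z ≠ x → V z < V x) := by
  have : Nonempty (Fin d) := ⟨⟨0, by omega⟩⟩
  set H := fderiv ℝ (gradient V) x with hHdef
  have hsph : IsCompact (sphere (0 : Euc d) 1) := isCompact_sphere 0 1
  have hne : (sphere (0 : Euc d) 1).Nonempty := NormedSpace.sphere_nonempty.2 zero_le_one
  have hcq : ContinuousOn (fun v : Euc d => ⟪H v, v⟫) (sphere (0 : Euc d) 1) := by
    apply Continuous.continuousOn; fun_prop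
  obtain ⟨v0, hv0, hmax⟩ := hsph.exists_isMaxOn hne hcq
  set κ := - ⟪H v0, v0⟫ with hκ
  have hκ0 : 0 < κ := by
    have := hH v0 (by rintro rfl; simp at hv0)
    simp only [hessQ] at this
    linarith
  have hquad : ∀ v : Euc d, ⟪H v, v⟫ ≤ -κ * ‖v‖ ^ 2 := by
    intro v
    by_cases hv : v = 0
    · simp [hv]
    have hnv : 0 < ‖v‖ := norm_pos_iff.2 hv
    have h1 : ⟪H (‖v‖⁻¹ • v), ‖v‖⁻¹ • v⟫ ≤ ⟪H v0, v0⟫ :=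
      hmax (by simp [norm_smul, hnv.ne'] : ‖v‖⁻¹ • v ∈ sphere (0 : Euc d) 1)
    rw [map_smul, real_inner_smul_left, real_inner_smul_right] at h1
    have h2 : ⟪H v, v⟫ = ‖v‖ ^ 2 * (‖v‖⁻¹ * (‖v‖⁻¹ * ⟪H v, v⟫)) := by field_simp
    rw [h2]
    have := mul_le_mul_of_nonneg_left h1 (sq_nonneg ‖v‖)
    linarith
  have hder : HasFDerivAt (gradient V) H x :=
    ((aux_grad_contDiff V hV).differentiable (by norm_num) x).hasFDerivAt
  have hlo := (hasFDerivAt_iff_isLittleO_nhds_zero.1 hder).def (half_pos hκ0)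
  obtain ⟨R, hR, hRb⟩ := Metric.eventually_nhds_iff_ball.1 hlo
  have hneg : ∀ h : Euc d, h ≠ 0 → ‖h‖ < R → ⟪gradient V (x + h), h⟫ < 0 := by
    intro h h0 hhR
    have h1 := hRb h (by simpa using hhR)
    rw [hx, sub_zero] at h1
    have h2 := real_inner_le_norm (gradient V (x + h) - H h) h
    rw [inner_sub_left] at h2
    have h3 := mul_le_mul_of_nonneg_right h1 (norm_nonneg h)
    have h4 := hquad h
    have h5 : 0 < ‖h‖ ^ 2 := pow_pos (norm_pos_iff.2 h0) 2
    nlinarith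
  have hlt : ∀ z ∈ ball x R, z ≠ x → V z < V x := by
    intro z hz hzx
    rw [mem_ball, dist_eq_norm] at hz
    have h := aux_anti V hV x (z - x) 1 (by
      intro s hs
      have h1 := hneg (s • (z - x)) (smul_ne_zero hs.1.ne' (sub_ne_zero.2 hzx)) (by
        rw [norm_smul, Real.norm_of_nonneg hs.1.le]
        nlinarith [hs.2, norm_nonneg (z - x)])
      rw [real_inner_smul_right] at h1
      by_contra hcon
      push Not at hcon
      have := mul_nonneg hs.1.le hcon
      linarith)
    have := h (left_mem_Icc.2 zero_le_one) (right_mem_Icc.2 zero_le_one) zero_lt_one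
    simpa using this
  have hrank : 1 < Module.rank ℝ (Euc d) := by
    rw [← Module.finrank_eq_rank, finrank_euclideanSpace_fin]
    exact_mod_cast hd
  have hpc : IsPathConnected ((fun w : Euc d => x + (R / (1 + ‖w‖)) • w) '' {0}ᶜ) := by
    apply (isPathConnected_compl_singleton_of_one_lt_rank hrank 0).image'
    apply Continuous.continuousOn
    have : Continuous fun w : Euc d => R / (1 + ‖w‖) := 
      continuous_const.div (by fun_prop) (fun w => by positivity)
    fun_prop
  have him : ∀ z ∈ ball x R, z ≠ x → z ∈ ((fun w : Euc d => x + (R / (1 + ‖w‖)) • w) '' {0}ᶜ) := by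
    intro z hz hzx
    rw [mem_ball, dist_eq_norm] at hz
    have hpos : 0 < R - ‖z - x‖ := by linarith
    refine ⟨(R - ‖z - x‖)⁻¹ • (z - x), ?_, ?_⟩
    · simp only [mem_compl_iff, mem_singleton_iff]
      exact smul_ne_zero (inv_ne_zero hpos.ne') (sub_ne_zero.2 hzx)
    · simp only [norm_smul, norm_inv, Real.norm_of_nonneg hpos.le, smul_smul]
      have : R / (1 + (R - ‖z - x‖)⁻¹ * ‖z - x‖) * (R - ‖z - x‖)⁻¹ = 1 := by
        field_simp
        ring_nf
      rw [this, one_smul]; abel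
  refine ⟨ball x R, isOpen_ball, mem_ball_self hR, ?_, hlt⟩
  intro y hy z hz hyx hzx
  refine (hpc.joinedIn y (him y hy (by rintro rfl; exact lt_irrefl _ hyx)) z
    (him z hz (by rintro rfl; exact lt_irrefl _ hzx))).mono ?_
  rintro _ ⟨w, hw, rfl⟩
  have hw0 : w ≠ 0 := hw
  apply hlt
  · have h1 : 0 < 1 + ‖w‖ := by positivity
    simp only [mem_ball, dist_eq_norm, add_sub_cancel_left, norm_smul, norm_div,
      Real.norm_of_nonneg hR.le, Real.norm_of_nonneg h1.le]
    rw [div_mul_eq_mul_div, div_lt_iff₀ h1]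
    nlinarith
  · simp only [ne_eq, add_eq_left]
    exact smul_ne_zero (by positivity) hw0

lemma aux_mp {d : ℕ} (V : Euc d → ℝ) (hV : Continuous V)
    (hco : Tendsto V (cocompact (Euc d)) atTop)
    (hloc : ∀ x, IsLocalMin V x ∨ ∃ W : Set (Euc d), IsOpen W ∧ x ∈ W ∧
      (∀ y ∈ W, ∀ z ∈ W, V y < V x → V z < V x → JoinedIn {w | V w < V x} y z) ∧
      (∀ z ∈ W, z ≠ x → V z ≤ V x → z ∈ closure {w | V w < V x}))
    (p q : Euc d) (hpq : V p < V q) (hq : IsLocalMin V q) : False := by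
  set G : Set ℝ := {c | JoinedIn {w | V w < c} p q} with hG
  have hGb : ∀ c ∈ G, V q ≤ c := fun c hc => le_of_lt hc.target_mem
  have hGbdd : BddBelow G := ⟨V q, hGb⟩
  have hGne : G.Nonempty := by
    have hseg : IsCompact (segment ℝ p q) := by
      rw [segment_eq_image']
      exact isCompact_Icc.image (by fun_prop)
    obtain ⟨M, hM⟩ := (hseg.image hV).bddAbove
    refine ⟨M + 1, JoinedIn.of_segment_subset fun z hz => ?_⟩
    have : V z ≤ M := hM ⟨z, hz, rfl⟩
    simp only [mem_ofPred_eq]; linarith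
  set c := sInf G with hc
  have hqc : V q ≤ c := le_csInf hGne hGb
  have hcG : c ∉ G := by
    intro h
    obtain ⟨M, ⟨t, ht⟩, hM⟩ := (isCompact_range (hV.comp h.somePath.continuous)).exists_isGreatest
      (range_nonempty _)
    have hMc : M < c := by rw [← ht]; exact h.somePath_mem t
    have : (M + c) / 2 ∈ G := by
      refine ⟨h.somePath, fun s => ?_⟩
      have : V (h.somePath s) ≤ M := hM ⟨s, rfl⟩
      simp only [mem_ofPred_eq]; linarith
    have := csInf_le hGbdd this
    linarith
  have hgt : ∀ c', c < c' → c' ∈ G := by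
    intro c' h
    obtain ⟨b, hb, hbc⟩ := exists_lt_of_csInf_lt hGne h
    exact JoinedIn.mono hb fun w (hw : V w < b) => hw.trans hbc
  have hAo : IsOpen {w | V w < c} := isOpen_lt hV continuous_const
  set F := pathComponentIn {w | V w < c} p with hF
  have hFo : IsOpen F := hAo.pathComponentIn p
  have hpF : p ∈ F := mem_pathComponentIn_self (hpq.trans_le hqc)
  have hFA : F ⊆ {w | V w < c} := pathComponentIn_subset
  have hcl : IsClosed {w | V w ≤ c} := isClosed_le hV continuous_const
  have hKle : ∀ x ∈ closure F, V x ≤ c :=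
    closure_minimal (fun x hx => le_of_lt (show V x < c from hFA hx)) hcl
  have hK : IsCompact (closure F) := by
    have h := hco.eventually (eventually_gt_atTop c)
    obtain ⟨T, hT, hTs⟩ := mem_cocompact.1 h
    refine hT.of_isClosed_subset isClosed_closure fun x hx => ?_
    by_contra hxT
    have : c < V x := hTs hxT
    linarith [hKle x hx]
  have hlt : ∀ x ∈ closure F, V x < c → x ∈ F := by
    intro x hx hxc
    obtain ⟨y, hy1, hy2⟩ := mem_closure_iff.1 hx _ (hAo.pathComponentIn x)
      (mem_pathComponentIn_self hxc)
    exact JoinedIn.trans hy2 (JoinedIn.symm hy1)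
  have hnm : ∀ x ∈ closure F, V x = c → ¬ IsLocalMin V x := by
    intro x hx hxc hm
    obtain ⟨y, hy1, hy2⟩ := mem_closure_iff_nhds.1 hx _ hm
    have : V y < c := hFA hy2
    have : V x ≤ V y := hy1
    linarith
  have hiso : ∀ x ∈ closure F, ∃ W : Set (Euc d), IsOpen W ∧ x ∈ W ∧
      ∀ z ∈ W, V z ≤ c → z ∈ closure F := by
    intro x hx
    rcases (hKle x hx).lt_or_eq with h | h
    · exact ⟨F, hFo, hlt x hx h, fun z hz _ => subset_closure hz⟩
    · rcases hloc x with hm | ⟨W, hW, hxW, hj, hcl⟩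
      · exact absurd hm (hnm x hx h)
      · refine ⟨W, hW, hxW, fun z hz hzc => ?_⟩
        rw [h] at hj hcl
        by_cases hzx : z = x
        · rw [hzx]; exact hx
        have h1 := hcl z hz hzx hzc
        obtain ⟨y, hyW, hyF⟩ := mem_closure_iff.1 hx W hW hxW
        have h1' := _root_.mem_closure_iff.1 h1
        refine _root_.mem_closure_iff.2 ?_
        intro o ho hzo
        obtain ⟨w, ⟨hwo, hwW⟩, hwA⟩ := h1' (o ∩ W) (ho.inter hW) ⟨hzo, hz⟩
        exact ⟨w, hwo, JoinedIn.trans hyF (hj y hyW w hwW (hFA hyF) hwA)⟩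
  choose! W hWo hWx hWK using hiso
  obtain ⟨O, hO, hKO, hOc, hOcomp⟩ := exists_open_between_and_isCompact_closure hK
    (isOpen_biUnion (s := closure F) (f := W) hWo) (fun x hx => mem_biUnion hx (hWx x hx))
  have hOK : ∀ z ∈ closure O, V z ≤ c → z ∈ closure F := by
    intro z hz hzc
    obtain ⟨x, hx, hzx⟩ := mem_iUnion₂.1 (hOc hz)
    exact hWK x hx z hzx hzc
  have hqK : q ∉ closure F := by
    intro h
    rcases hqc.lt_or_eq with h' | h'
    · exact hcG (hlt q h h')
    · exact hnm q h h' hq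
  have hqO : q ∉ O := fun h => hqK (hOK q (subset_closure h) hqc)
  have hfr : ∀ z ∈ frontier O, c < V z := by
    intro z hz
    by_contra hcon
    push Not at hcon
    rw [hO.frontier_eq] at hz
    exact hz.2 (hKO (hOK z hz.1 hcon))
  have hcross : ∀ c', c < c' → ∃ z ∈ frontier O, V z < c' := by
    intro c' h
    have hj : JoinedIn {w | V w < c'} p q := hgt c' h
    have hpre : IsPreconnected (range hj.somePath) := isPreconnected_range hj.somePath.continuous
    obtain ⟨z, ⟨s, rfl⟩, hz⟩ := aux_cross hpre hO
      ⟨p, ⟨0, by simp⟩, hKO (subset_closure hpF)⟩ ⟨q, ⟨1, by simp⟩, hqO⟩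
    exact ⟨_, hz, hj.somePath_mem s⟩
  have hfc : IsCompact (frontier O) :=
    hOcomp.of_isClosed_subset isClosed_frontier frontier_subset_closure
  obtain ⟨z0, hz0, hmin⟩ := hfc.exists_isMinOn
    (by obtain ⟨z, hz, -⟩ := hcross (c + 1) (by linarith); exact ⟨z, hz⟩) hV.continuousOn
  obtain ⟨z, hz, hzlt⟩ := hcross (V z0) (hfr z0 hz0)
  exact absurd (hmin hz) (not_le.2 hzlt)

lemma aux_S_zero {d : ℕ} (hd : 2 ≤ d) (V : Euc d → ℝ) (hV : ContDiff ℝ 2 V)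
    (ν : ℝ) (hν : 0 < ν) (𝒩 : Set (Euc d) → Set (Euc d)) (h2 : Assumption2 V 𝒩)
    (hco : Tendsto V (cocompact (Euc d)) atTop)
    (hS : IsClosed (localMinSet V)) (hSn : (localMinSet V).Nonempty)
    (heb : ∀ x ∈ NSet V 𝒩, ν * infDist x (localMinSet V) ≤ ‖gradient V x‖)
    (p q : Euc d) (hpq : V p < V q) (hq : IsLocalMin V q) : False := by
  refine aux_mp V hV.continuous hco (fun x => ?_) p q hpq hq
  by_cases hg : gradient V x = 0
  · by_cases hN : x ∈ NSet V 𝒩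
    · left; exact aux_crit V hV ν hν 𝒩 hS hSn heb x (subset_closure hN) hg
    · right
      obtain ⟨W, h1, h3, h4, h5⟩ := aux_strictmax hd V hV x hg (h2 x hN hg)
      exact ⟨W, h1, h3, h4, fun z hz hzx _ => subset_closure (h5 z hz hzx)⟩
  · right
    obtain ⟨W, h1, h3, h4, h5⟩ := aux_noncrit V hV x hg
    exact ⟨W, h1, h3, h4, fun z hz _ h => h5 z hz h⟩

lemma aux_unif_integral {d : ℕ} (U : Set (Euc d)) (g : Euc d → ℝ) :
    ∫ x, g x ∂(uniformOn U) = (volume U).toReal⁻¹ * ∫ x in U, g x := by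
  rw [uniformOn, integral_smul_measure, ENNReal.toReal_inv, smul_eq_mul]

lemma aux_unif_const {d : ℕ} (U : Set (Euc d)) (hU : IsCompact U) (f : Euc d → ℝ)
    (hf : Continuous f) (a : ℝ) (x : Euc d) (hx : x ∈ interior U)
    (h : ∫ y, (f y - a) ^ 2 ∂(uniformOn U) ≤ 0) : f x = a := by
  have hfin : volume U ≠ ∞ := hU.measure_lt_top.ne
  have hpos : volume U ≠ 0 := 
    (Measure.measure_pos_of_nonempty_interior volume ⟨x, hx⟩).ne'
  have hvp : 0 < (volume U).toReal := ENNReal.toReal_pos hpos hfin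
  rw [aux_unif_integral] at h
  have hc : Continuous fun y => (f y - a) ^ 2 := by fun_prop
  have hint : Integrable (fun y => (f y - a) ^ 2) (volume.restrict U) :=
    hc.continuousOn.integrableOn_compact hU
  have h0 : ∫ y in U, (f y - a) ^ 2 = 0 := by
    apply le_antisymm
    · by_contra hcon
      push Not at hcon
      have := mul_pos (inv_pos.2 hvp) hcon
      linarith
    · exact integral_nonneg fun y => sq_nonneg _
  rw [integral_eq_zero_iff_of_nonneg (fun y => sq_nonneg _) hint] at h0
  have h1 : f =ᵐ[volume.restrict (interior U)] fun _ => a := by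
    have := ae_restrict_of_ae_restrict_of_subset interior_subset h0
    filter_upwards [this] with y hy
    have : f y - a = 0 := by simpa using hy
    linarith
  exact Measure.eqOn_open_of_ae_eq h1 isOpen_interior hf.continuousOn continuousOn_const hx

lemma aux_integrable_unif {d : ℕ} (U : Set (Euc d)) (hU : IsCompact U) 
    (hpos : volume U ≠ 0) (g : Euc d → ℝ) (hg : Continuous g) :
    Integrable g (uniformOn U) := by
  have : Integrable g (volume.restrict U) := hg.continuousOn.integrableOn_compact hU
  exact this.smul_measure (ENNReal.inv_ne_top.2 hpos)

lemma aux_grad_cont1 {d : ℕ} (f : Euc d → ℝ) (hf : ContDiff ℝ 1 f) :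
    Continuous (gradient f) := by
  have h : Continuous (fderiv ℝ f) := hf.continuous_fderiv (by norm_num)
  exact (InnerProductSpace.toDual ℝ (Euc d)).symm.continuous.comp h

lemma aux_PI_zero {d : ℕ} (U : Set (Euc d)) (hU : IsCompact U) (ρ : ℝ)
    (hPI : PoincareIneq (uniformOn U) ρ) (f : Euc d → ℝ) (hf : ContDiff ℝ 1 f)
    (h : (1 / ρ) * ∫ x, ‖gradient f x‖ ^ 2 ∂(uniformOn U) ≤ 0)
    (x y : Euc d) (hx : x ∈ interior U) (hy : y ∈ interior U) : f x = f y := by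
  have hpos : volume U ≠ 0 := (Measure.measure_pos_of_nonempty_interior volume ⟨x, hx⟩).ne'
  have h1 := hPI f hf (aux_integrable_unif U hU hpos _ (hf.continuous.pow 2))
    (aux_integrable_unif U hU hpos _ ((aux_grad_cont1 f hf).norm.pow 2))
  have h2 := h1.trans h
  rw [aux_unif_const U hU f hf.continuous _ x hx h2, aux_unif_const U hU f hf.continuous _ y hy h2]

lemma aux_rho_pos {d : ℕ} (hd : 1 ≤ d) (U : Set (Euc d)) (hU : IsCompact U) (ρ : ℝ)
    (hPI : PoincareIneq (uniformOn U) ρ) (hi : (interior U).Nonempty) : 0 < ρ := by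
  by_contra hρ
  push Not at hρ
  obtain ⟨x, hx⟩ := hi
  obtain ⟨r, hr, hb⟩ := Metric.isOpen_iff.1 isOpen_interior x hx
  set e : Euc d := EuclideanSpace.single ⟨0, hd⟩ 1 with he
  have hne : ‖e‖ = 1 := by simp [he]
  have h := aux_PI_zero U hU ρ hPI (fun y => ⟪e, y⟫) (contDiff_const.inner ℝ contDiff_id)
    (mul_nonpos_of_nonpos_of_nonneg (one_div_nonpos.2 hρ)
      (integral_nonneg fun y => sq_nonneg _)) x (x + (r / 2) • e) hx
    (hb (by
      rw [mem_ball, dist_eq_norm, add_sub_cancel_left, norm_smul, hne,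
        Real.norm_of_nonneg (by positivity)]; linarith))
  simp only [inner_add_right, real_inner_smul_right, real_inner_self_eq_norm_sq, hne] at h
  linarith

lemma aux_gibbs_integral {d : ℕ} (V : Euc d → ℝ) (hV : Continuous V) (ε : ℝ) (U : Set (Euc d)) 
    (g : Euc d → ℝ) :
    ∫ x, g x ∂(gibbsOn V ε U) =
      (∫ x in U, exp (-V x / ε))⁻¹ * ∫ x in U, exp (-V x / ε) * g x := by
  have hm : Measurable fun x => ENNReal.ofReal (exp (-V x / ε)) := by
    have : Continuous fun x => exp (-V x / ε) := by fun_prop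
    exact (ENNReal.continuous_ofReal.comp this).measurable
  rw [gibbsOn, integral_smul_measure, ENNReal.toReal_inv,
    ENNReal.toReal_ofReal (integral_nonneg fun x => (exp_pos _).le), smul_eq_mul,
    integral_withDensity_eq_integral_toReal_smul hm (by simp)]
  congr 2
  ext x
  rw [ENNReal.toReal_ofReal (exp_pos _).le, smul_eq_mul]

lemma aux_Z_pos {d : ℕ} (V : Euc d → ℝ) (hV : Continuous V) (ε : ℝ) (U : Set (Euc d)) 
    (hU : IsCompact U) (hpos : volume U ≠ 0) : 0 < ∫ x in U, exp (-V x / ε) := by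
  have hc : Continuous fun x => exp (-V x / ε) := by fun_prop
  have hint : IntegrableOn (fun x => exp (-V x / ε)) U := hc.continuousOn.integrableOn_compact hU
  rw [setIntegral_pos_iff_support_of_nonneg_ae (ae_of_all _ fun x => (exp_pos _).le) hint]
  have : Function.support (fun x => exp (-V x / ε)) = univ := by
    ext x; simp [(exp_pos _).ne']
  rw [this, univ_inter]
  exact pos_iff_ne_zero.2 hpos

lemma aux_HS {d : ℕ} (V : Euc d → ℝ) (hV : Continuous V) (ε : ℝ) (U : Set (Euc d)) 
    (hU : IsCompact U) (hpos : volume U ≠ 0) (K : ℝ) (hw1 : ∀ x ∈ U, exp (-V x / ε) ≤ 1)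
    (hw2 : ∀ x ∈ U, exp (-K) ≤ exp (-V x / ε)) (ρ : ℝ) (hρ : 0 < ρ)
    (hPI : PoincareIneq (uniformOn U) ρ) : PoincareIneq (gibbsOn V ε U) (exp (-K) * ρ) := by
  intro f hf _ _
  have hfin : volume U ≠ ∞ := hU.measure_lt_top.ne
  have hvp : 0 < (volume U).toReal := ENNReal.toReal_pos hpos hfin
  have hZ := aux_Z_pos V hV ε U hU hpos
  have h1 := hPI f hf (aux_integrable_unif U hU hpos _ (hf.continuous.pow 2))
    (aux_integrable_unif U hU hpos _ ((aux_grad_cont1 f hf).norm.pow 2))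
  set a := ∫ y, f y ∂(uniformOn U)
  rw [aux_unif_integral, aux_unif_integral] at h1
  have hfc := hf.continuous
  have hgc := aux_grad_cont1 f hf
  have hint : ∀ g : Euc d → ℝ, Continuous g → Integrable g (volume.restrict U) :=
    fun g hg => hg.continuousOn.integrableOn_compact hU
  have hm := aux_gibbs_integral V hV ε U f
  set m := ∫ y, f y ∂(gibbsOn V ε U)
  rw [aux_gibbs_integral V hV, aux_gibbs_integral V hV]
  set Z := ∫ x in U, exp (-V x / ε) with hZdef
  have hmZ : ∫ x in U, exp (-V x / ε) * f x = m * Z := by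
    rw [hm]; field_simp
  have hvar : ∫ x in U, exp (-V x / ε) * (f x - m) ^ 2 ≤ ∫ x in U, exp (-V x / ε) * (f x - a) ^ 2 := by
    have hexp : ∀ x, exp (-V x / ε) * (f x - a) ^ 2 = exp (-V x / ε) * (f x - m) ^ 2
        + ((2 * (m - a)) * (exp (-V x / ε) * f x) + ((m - a) ^ 2 - 2 * (m - a) * m) * exp (-V x / ε)) := by
      intro x; ring
    simp_rw [hexp]
    rw [integral_add (hint _ (by fun_prop)) (hint _ (by fun_prop)),
      integral_add (hint _ (by fun_prop)) (hint _ (by fun_prop)),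
      integral_const_mul, integral_const_mul, hmZ, ← hZdef]
    have : 0 ≤ (m - a) ^ 2 * Z := by positivity
    nlinarith
  have hup : ∫ x in U, exp (-V x / ε) * (f x - a) ^ 2 ≤ ∫ x in U, (f x - a) ^ 2 := by
    apply setIntegral_mono_on (hint _ (by fun_prop)) (hint _ (by fun_prop)) hU.measurableSet
    intro x hx
    exact mul_le_of_le_one_left (sq_nonneg _) (hw1 x hx)
  have hlow : exp (-K) * ∫ x in U, ‖gradient f x‖ ^ 2 ≤
      ∫ x in U, exp (-V x / ε) * ‖gradient f x‖ ^ 2 := by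
    rw [← integral_const_mul]
    apply setIntegral_mono_on (hint _ (by fun_prop)) (hint _ (by fun_prop)) hU.measurableSet
    intro x hx
    exact mul_le_mul_of_nonneg_right (hw2 x hx) (sq_nonneg _)
  have h2 : ∫ x in U, (f x - a) ^ 2 ≤ (1 / ρ) * ∫ x in U, ‖gradient f x‖ ^ 2 := by
    have := mul_le_mul_of_nonneg_left h1 hvp.le
    rw [mul_inv_cancel_left₀ hvp.ne'] at this
    calc _ ≤ _ := this
      _ = _ := by field_simp
  have hK := exp_pos (-K)
  have h3 : ∫ x in U, ‖gradient f x‖ ^ 2 ≤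
      (exp (-K))⁻¹ * ∫ x in U, exp (-V x / ε) * ‖gradient f x‖ ^ 2 := by
    rw [← div_eq_inv_mul, le_div_iff₀ hK]; linarith
  have h4 := mul_le_mul_of_nonneg_left h3 (one_div_pos.2 hρ).le
  have h5 := mul_le_mul_of_nonneg_left (hvar.trans (hup.trans (h2.trans h4))) (inv_pos.2 hZ).le
  calc _ ≤ _ := h5
    _ = _ := by field_simp

lemma aux_inner1 (x y : Euc 1) : ⟪x, y⟫ = x 0 * y 0 := by
  simp [PiLp.inner_apply, mul_comm]

lemma aux_norm1 (x : Euc 1) : ‖x‖ = |x 0| := by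
  simp [EuclideanSpace.norm_eq, Real.sqrt_sq_eq_abs]

lemma aux_dim1 (V : Euc 1 → ℝ) (hV : ContDiff ℝ 2 V) (r : ℝ) (hr : 0 < r)
    (hUc : IsCompact {y | infDist y (localMinSet V) ≤ r})
    (hcrit : ∀ x, infDist x (localMinSet V) ≤ r → gradient V x = 0 → x ∈ localMinSet V)
    (ρ : ℝ) (hPI : PoincareIneq (uniformOn {y | infDist y (localMinSet V) ≤ r}) ρ)
    (p q : Euc 1) (hp : p ∈ localMinSet V) (hq : q ∈ localMinSet V) (hpq : V p < V q) : False := by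
  set v := q - p with hv
  have hv0 : v ≠ 0 := by
    intro h
    rw [sub_eq_zero.1 h] at hpq
    exact lt_irrefl _ hpq
  have hvn : 0 < ‖v‖ := norm_pos_iff.2 hv0
  set φ : ℝ → ℝ := fun s => V (p + s • v) with hφ
  have hφc : Continuous φ := by
    have := hV.continuous
    fun_prop
  have hφ0 : φ 0 = V p := by simp [hφ]
  have hφ1 : φ 1 = V q := by simp [hφ, hv]
  obtain ⟨s1, hs1, hs1max⟩ := (isCompact_Icc (a := (0:ℝ)) (b := 1)).exists_isMaxOn
    ⟨0, by simp⟩ hφc.continuousOn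
  have hTc : IsCompact (Icc (0:ℝ) 1 ∩ {s | φ s1 ≤ φ s}) :=
    isCompact_Icc.inter_right (isClosed_le continuous_const hφc)
  obtain ⟨s0, ⟨hs0, hs0m⟩, hs0l⟩ := hTc.exists_isLeast ⟨s1, hs1, le_refl (φ s1)⟩
  have hmax : ∀ s ∈ Icc (0:ℝ) 1, φ s ≤ φ s0 := fun s hs => (hs1max hs).trans hs0m
  have hs0pos : 0 < s0 := by
    rcases hs0.1.lt_or_eq with h | h
    · exact h
    · have := hmax 1 (by simp)
      rw [← h, hφ0, hφ1] at this
      linarith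
  set x := p + s0 • v with hx
  have hxS : x ∉ localMinSet V := by
    intro hm
    have hc : Continuous fun s : ℝ => p + s • v := by fun_prop
    have hev : ∀ᶠ s in 𝓝 s0, φ s0 ≤ φ s := hc.continuousAt.eventually (show ∀ᶠ y in 𝓝 (p + s0 • v), V x ≤ V y from hm)
    have hev2 : ∀ᶠ s in 𝓝 s0, 0 < s := lt_mem_nhds hs0pos
    obtain ⟨η, hη, hb⟩ := Metric.eventually_nhds_iff_ball.1 (hev.and hev2)
    have h3 := hb (s0 - η / 2) (by
      rw [mem_ball, Real.dist_eq, abs_lt]; constructor <;> linarith)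
    have := hs0l (show s0 - η / 2 ∈ Icc (0:ℝ) 1 ∩ {s | φ s1 ≤ φ s} from
      ⟨⟨h3.2.le, by linarith [hs0.2]⟩, le_trans hs0m h3.1⟩)
    linarith
  have hs01 : s0 < 1 := by
    rcases hs0.2.lt_or_eq with h | h
    · exact h
    · exfalso; apply hxS; rw [hx, h, one_smul, hv, add_sub_cancel]; exact hq
  have hgx : gradient V x = 0 := by
    have hlm : IsLocalMax φ s0 := by
      filter_upwards [Icc_mem_nhds hs0pos hs01] with s hs using hmax s hs
    have h1 := hlm.hasDerivAt_eq_zero (aux_line V hV p v s0)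
    rw [← hx, aux_inner1] at h1
    have hv00 : v 0 ≠ 0 := by
      intro h; rw [aux_norm1, h] at hvn; simp at hvn
    have h2 : gradient V x 0 = 0 := (mul_eq_zero.1 h1).resolve_right hv00
    rw [← norm_eq_zero, aux_norm1, h2, abs_zero]
  have hxU : r < infDist x (localMinSet V) := by
    by_contra hcon
    push Not at hcon
    exact hxS (hcrit x hcon hgx)
  obtain ⟨η, hη, hb⟩ := Metric.isOpen_iff.1
    (isOpen_lt continuous_const (continuous_infDist_pt (localMinSet V))) x hxU
  set τ := η * ‖v‖ / 4 with hτ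
  have hτ0 : 0 < τ := by positivity
  have hfar : ∀ y, infDist y (localMinSet V) ≤ r → ⟪y - x, v⟫ < -τ ∨ 2 * τ < ⟪y - x, v⟫ := by
    intro y hy
    by_contra hcon
    push Not at hcon
    have h1 : |⟪y - x, v⟫| ≤ 2 * τ := abs_le.2 ⟨by linarith, hcon.2⟩
    rw [aux_inner1, abs_mul, ← aux_norm1, ← aux_norm1] at h1
    have h2 : ‖y - x‖ < η := by
      by_contra h
      push Not at h
      have := mul_le_mul_of_nonneg_right h hvn.le
      have : 0 < η * ‖v‖ := by positivity
      linarith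
    have : r < infDist y (localMinSet V) := hb (by rwa [mem_ball, dist_eq_norm])
    linarith
  set f : Euc 1 → ℝ := fun y => Real.smoothTransition (⟪y - x, v⟫ / τ) with hf
  have hfs : ContDiff ℝ 1 f := by
    apply Real.smoothTransition.contDiff.comp
    exact ((contDiff_id.sub contDiff_const).inner ℝ contDiff_const).div_const _
  have hcℓ : Continuous fun y : Euc 1 => ⟪y - x, v⟫ := by fun_prop
  have hgrad : ∀ y, infDist y (localMinSet V) ≤ r → gradient f y = 0 := by
    intro y hy
    have : ∃ k : ℝ, f =ᶠ[𝓝 y] fun _ => k := by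
      rcases hfar y hy with h | h
      · refine ⟨0, ?_⟩
        have : ∀ᶠ z in 𝓝 y, ⟪z - x, v⟫ < -τ := hcℓ.continuousAt.eventually (gt_mem_nhds h)
        filter_upwards [this] with z hz
        exact Real.smoothTransition.zero_of_nonpos (div_nonpos_of_nonpos_of_nonneg (by linarith) hτ0.le)
      · refine ⟨1, ?_⟩
        have : ∀ᶠ z in 𝓝 y, 2 * τ < ⟪z - x, v⟫ := hcℓ.continuousAt.eventually (lt_mem_nhds h)
        filter_upwards [this] with z hz
        exact Real.smoothTransition.one_of_one_le ((one_le_div hτ0).2 (by linarith))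
    obtain ⟨k, hk⟩ := this
    have : fderiv ℝ f y = 0 := by rw [hk.fderiv_eq]; simp
    simp [gradient, this]
  have hzero : ∫ y, ‖gradient f y‖ ^ 2 ∂(uniformOn {y | infDist y (localMinSet V) ≤ r}) = 0 := by
    rw [aux_unif_integral, setIntegral_congr_fun hUc.measurableSet (g := fun _ => (0:ℝ))]
    · simp
    · intro y hy
      simp [hgrad y hy]
  have hin : ∀ s ∈ localMinSet V, s ∈ interior {y | infDist y (localMinSet V) ≤ r} := by
    intro s hs
    rw [mem_interior]
    refine ⟨ball s r, fun y hy => ?_, isOpen_ball, mem_ball_self hr⟩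
    exact (infDist_le_dist_of_mem hs).trans (le_of_lt hy)
  have hfin := aux_PI_zero _ hUc ρ hPI f hfs (by rw [hzero, mul_zero]) p q (hin p hp) (hin q hq)
  have hpx : ⟪p - x, v⟫ ≤ 0 := by
    rw [hx, sub_add_cancel_left, inner_neg_left, real_inner_smul_left, real_inner_self_eq_norm_sq]
    have : 0 ≤ s0 * ‖v‖ ^ 2 := by positivity
    linarith
  have hqx : 0 < ⟪q - x, v⟫ := by
    have : q - x = (1 - s0) • v := by rw [hx, sub_smul, one_smul, hv]; abel
    rw [this, real_inner_smul_left, real_inner_self_eq_norm_sq]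
    have : 0 < 1 - s0 := by linarith
    positivity
  have hfp : f p = 0 :=
    Real.smoothTransition.zero_of_nonpos (div_nonpos_of_nonpos_of_nonneg hpx hτ0.le)
  have hfq : f q = 1 := by
    have hqU : infDist q (localMinSet V) ≤ r := by rw [infDist_zero_of_mem hq]; exact hr.le
    rcases hfar q hqU with h | h
    · linarith
    · exact Real.smoothTransition.one_of_one_le ((one_le_div hτ0).2 (by linarith))
  rw [hfp, hfq] at hfin
  norm_num at hfin

/-- perturbation near the optimal set. If the uniform measure on
`U = {dist(·,S) ≤ √(Cε)}` (with `C = 4M_Δ/ν²`) satisfies PI(ρ_U), then the truncated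
Gibbs measure `μ_{ε,U}` satisfies PI(ρ_{ε,U}) with `exp(4LC) ρ_{ε,U} ≥ ρ_U`; namely it
satisfies PI with constant `exp(-4LC)·ρ_U`. -/
theorem truncated_gibbs_poincare_from_uniform
    {d : ℕ} (V : Euc d → ℝ) (hV : ContDiff ℝ 2 V)
    (ν : ℝ) (𝒩 : Set (Euc d) → Set (Euc d))
    (h1 : Assumption1 V ν 𝒩) (h2 : Assumption2 V 𝒩)
    (R₀ ν_eb C_g : ℝ) (h3 : Assumption3 V R₀ ν_eb C_g)
    (hmin0 : ∀ x, 0 ≤ V x) (hmin : ∃ x, V x = 0)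
    (δ₀ : ℝ) (hδ₀ : 0 < δ₀)
    (hδ : ∀ x ∈ frontier (NSet V 𝒩), δ₀ ≤ infDist x (localMinSet V))
    (R₁ μm : ℝ) (hR₁ : 0 < R₁) (hμm : 0 < μm)
    (hhess : ∀ x ∈ maxNbhd V R₁, ∀ v : Euc d, hessQ V x v ≤ -μm * ‖v‖ ^ 2)
    (g₀ : ℝ) (hg₀ : 0 < g₀)
    (hg : ∀ x : Euc d, x ∉ maxNbhd V R₁ ∪ NSet V 𝒩 → g₀ ≤ ‖gradient V x‖)
    (MΔ : ℝ) (hMΔ : ∀ x : Euc d, ‖x‖ ≤ 2 * R₀ → |lap V x| ≤ MΔ) (hMΔμ : d * μm ≤ MΔ)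
    (L : ℝ) (hL : ∀ x ∈ NSet V 𝒩, ‖fderiv ℝ (gradient V) x‖ ≤ L)
    (heb : ∀ x ∈ NSet V 𝒩, ν * infDist x (localMinSet V) ≤ ‖gradient V x‖)
    (ε : ℝ) (hε : 0 < ε)
    (hε1 : ε ≤ ν_eb ^ 2 / (64 * C_g)) (hε2 : ε ≤ δ₀ ^ 2 / (4 * MΔ / ν ^ 2))
    (hε3 : ε ≤ g₀ ^ 2 / (4 * MΔ))
    (ρU : ℝ)
    (hPI : PoincareIneq
      (uniformOn {y : Euc d | infDist y (localMinSet V) ≤ Real.sqrt (4 * MΔ / ν ^ 2 * ε)})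
      ρU) :
    PoincareIneq
      (gibbsOn V ε {y : Euc d | infDist y (localMinSet V) ≤ Real.sqrt (4 * MΔ / ν ^ 2 * ε)})
      (exp (-(4 * L * (4 * MΔ / ν ^ 2))) * ρU) := by
  have hν := h1.1
  obtain ⟨p0, hp0⟩ := hmin
  have hp0S : p0 ∈ localMinSet V := by
    show IsLocalMin V p0
    exact Eventually.of_forall fun y => by rw [hp0]; exact hmin0 y
  have hSn : (localMinSet V).Nonempty := ⟨p0, hp0S⟩
  have hS := aux_S_closed V hV ν 𝒩 h1 hmin0 δ₀ hδ₀ hδ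
  have hScomp : IsCompact (localMinSet V) :=
    (isCompact_closedBall 0 R₀).of_isClosed_subset hS h3.2.2.2.2.2
  set C := 4 * MΔ / ν ^ 2 with hC
  set r := √(C * ε) with hr
  have hUclosed : IsClosed {y : Euc d | infDist y (localMinSet V) ≤ r} :=
    isClosed_le (continuous_infDist_pt _) continuous_const
  have hUcomp : IsCompact {y : Euc d | infDist y (localMinSet V) ≤ r} := by
    refine (isCompact_closedBall (0 : Euc d) (R₀ + r)).of_isClosed_subset hUclosed fun y hy => ?_
    obtain ⟨p, hp, hpy⟩ := hS.exists_infDist_eq_dist hSn y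
    have h4 : ‖p‖ ≤ R₀ := by simpa using h3.2.2.2.2.2 hp
    have h5 : dist y p ≤ r := by rw [← hpy]; exact hy
    rw [mem_closedBall_zero_iff]
    have h6 : ‖y‖ ≤ ‖p‖ + ‖y - p‖ := by
      have := norm_add_le p (y - p)
      rwa [add_sub_cancel] at this
    rw [dist_eq_norm] at h5
    linarith
  rcases Nat.eq_zero_or_pos d with hd0 | hd
  · subst hd0
    intro f hf _ _
    have hUu : {y : Euc 0 | infDist y (localMinSet V) ≤ r} = univ := by
      ext y
      rw [Subsingleton.elim y p0]
      simp only [mem_ofPred_eq, mem_univ, iff_true]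
      rw [infDist_zero_of_mem hp0S]; exact Real.sqrt_nonneg _
    have hpos : volume {y : Euc 0 | infDist y (localMinSet V) ≤ r} ≠ 0 := by
      rw [hUu]; exact (Measure.measure_pos_of_nonempty_interior volume ⟨p0, by simp⟩).ne'
    have hZ := aux_Z_pos V hV.continuous ε _ hUcomp hpos
    have hfc : ∀ y, f y = f p0 := fun y => by rw [Subsingleton.elim y p0]
    have hm : ∫ y, f y ∂(gibbsOn V ε {y : Euc 0 | infDist y (localMinSet V) ≤ r}) = f p0 := by
      rw [aux_gibbs_integral V hV.continuous]
      simp_rw [hfc]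
      rw [integral_mul_const, inv_mul_cancel_left₀ hZ.ne']
    have hl : ∀ x, (f x - ∫ y, f y ∂(gibbsOn V ε {y : Euc 0 | infDist y (localMinSet V) ≤ r})) ^ 2 = 0 := by
      intro x; rw [hm, hfc x]; simp
    have hg0 : ∀ x, gradient f x = 0 := fun x => Subsingleton.elim _ _
    simp_rw [hl, hg0]
    simp
  have hM : 0 < MΔ := by
    have : (0:ℝ) < d * μm := by positivity
    linarith
  have hCpos : 0 < C := by positivity
  have hr0 : 0 < r := Real.sqrt_pos.2 (by positivity)
  have hrsq : r ^ 2 = C * ε := Real.sq_sqrt (by positivity)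
  have hrδ : r ≤ δ₀ := by
    rw [le_div_iff₀ hCpos] at hε2
    rw [hr, Real.sqrt_le_left hδ₀.le]
    linarith
  have hin : p0 ∈ interior {y : Euc d | infDist y (localMinSet V) ≤ r} := by
    rw [mem_interior]
    refine ⟨ball p0 r, fun y hy => ?_, isOpen_ball, mem_ball_self hr0⟩
    exact (infDist_le_dist_of_mem hp0S).trans (le_of_lt hy)
  have hρ := aux_rho_pos hd _ hUcomp ρU hPI ⟨p0, hin⟩
  have hSzero : ∀ q ∈ localMinSet V, V q = 0 := by
    intro q hq
    by_contra hne
    have hlt : V p0 < V q := by rw [hp0]; exact lt_of_le_of_ne (hmin0 q) (Ne.symm hne)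
    rcases (Nat.lt_or_ge 1 d) with h | h
    · exact aux_S_zero h V hV ν hν 𝒩 h2 h3.2.2.2.2.1 hS hSn heb p0 q hlt hq
    · obtain rfl : d = 1 := le_antisymm h hd
      refine aux_dim1 V hV r hr0 hUcomp (fun x hx hg => ?_) ρU hPI p0 q hp0S hq hlt
      exact aux_crit V hV ν hν 𝒩 hS hSn heb x
        (aux_U V hV ν 𝒩 h1 hS hSn δ₀ hδ₀ hδ L hL x (hx.trans hrδ)).1 hg
  have hL0 : 0 ≤ L := (norm_nonneg _).trans (hL p0 (aux_S_sub_N V ν 𝒩 h1 hp0S))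
  refine aux_HS V hV.continuous ε _ hUcomp
    (Measure.measure_pos_of_nonempty_interior volume ⟨p0, hin⟩).ne' (4 * L * C) ?_ ?_ ρU hρ hPI
  · intro x _
    rw [exp_le_one_iff]
    exact div_nonpos_of_nonpos_of_nonneg (by linarith [hmin0 x]) hε.le
  · intro x hx
    have hx' : infDist x (localMinSet V) ≤ r := hx
    obtain ⟨-, p, hp, hle⟩ := aux_U V hV ν 𝒩 h1 hS hSn δ₀ hδ₀ hδ L hL x (hx'.trans hrδ)
    rw [hSzero p hp, zero_add] at hle
    have h4 : infDist x (localMinSet V) ^ 2 ≤ C * ε := by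
      rw [← hrsq]; exact pow_le_pow_left₀ infDist_nonneg hx' 2
    have h5 := mul_le_mul_of_nonneg_left h4 hL0
    rw [exp_le_exp, le_div_iff₀ hε]
    have : 0 ≤ L * (C * ε) := by positivity
    nlinarith
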